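/- Let N be a seminorm on ℝᵈ taking integer values on ℤᵈ, and let B*_N = {y ∈ ℝᵈ : ⟨x,y⟩ ≤ N(x) for all x ∈ ℝᵈ} be its dual unit ball. Then B*_N ∩ ℤᵈ is a finite set and B*_N is the convex hull of B*_N ∩ ℤᵈ; in particular B*_N is the convex hull of finitely many points of ℤᵈ. -/

import Mathlib

/-- `N` is a seminorm on `ℝᵈ = Fin d → ℝ`: absolutely homogeneous and subadditive. -/
def IsSeminorm {d : ℕ} (N : (Fin d → ℝ) → ℝ) : Prop :=
  (∀ (c : ℝ) (x : Fin d → ℝ), N (c • x) = |c| * N x) ∧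
  ∀ x y : Fin d → ℝ, N (x + y) ≤ N x + N y

/-- A point of `ℝᵈ` belongs to the integer lattice `ℤᵈ`. -/
def IsIntegerPoint {d : ℕ} (y : Fin d → ℝ) : Prop := ∀ i, ∃ m : ℤ, y i = (m : ℝ)

/-- An integer-valued function on an abelian group that is subadditive and homogeneous under
natural multiples. -/
structure IsIntSublinear {A : Type*} [AddCommGroup A] (f : A → ℤ) : Prop where
  add_le : ∀ x y, f (x + y) ≤ f x + f y
  nsmul : ∀ (n : ℕ) x, f (n • x) = n * f x

namespace IsIntSublinear

variable {A : Type*} [AddCommGroup A] {f g : A → ℤ}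

lemma map_zero (hf : IsIntSublinear f) : f 0 = 0 := by
  simpa using hf.nsmul 0 0

lemma add_neg_nonneg (hf : IsIntSublinear f) (x : A) : 0 ≤ f x + f (-x) := by
  have h := hf.add_le x (-x)
  rwa [add_neg_cancel, hf.map_zero] at h

lemma map_neg_of_le (hg : IsIntSublinear g) (hle : ∀ x, g x ≤ f x) {w : A}
    (hw : f (-w) = -f w) : g (-w) = -g w ∧ g w = f w := by
  have h₁ := hg.add_neg_nonneg w
  have h₂ := hle w
  have h₃ := hle (-w)
  omega

lemma map_add_of_map_neg (hf : IsIntSublinear f) {w : A} (hw : f (-w) = -f w) (x : A) :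
    f (x + w) = f x + f w := by
  have h₁ := hf.add_le x w
  have h₂ := hf.add_le (x + w) (-w)
  rw [add_neg_cancel_right] at h₂
  omega

/-- The increments of `f` in the direction `v` are eventually constant. -/
lemma eventually_const (hf : IsIntSublinear f) (v x : A) :
    ∃ c : ℤ, ∃ n₀ : ℕ, ∀ n : ℕ, n₀ ≤ n → f (x + n • v) - n * f v = c := by
  have hbdd : ∀ n : ℕ, -f (-x) ≤ f (x + n • v) - n * f v := fun n => by
    have h := hf.add_le (x + n • v) (-x)
    rw [add_neg_cancel_comm, hf.nsmul] at h
    omega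
  have hanti : Antitone fun n : ℕ => f (x + n • v) - n * f v := by
    refine antitone_nat_of_succ_le fun n => ?_
    have h := hf.add_le (x + n • v) v
    rw [add_assoc, ← succ_nsmul] at h
    push_cast
    linarith
  obtain ⟨c, ⟨n₀, hn₀⟩, hmin⟩ := Int.exists_least_of_bdd
    (P := fun z => ∃ n : ℕ, f (x + n • v) - n * f v = z)
    ⟨-f (-x), by rintro z ⟨n, rfl⟩; exact hbdd n⟩ ⟨_, 0, rfl⟩
  exact ⟨c, n₀, fun n hn => le_antisymm (hn₀ ▸ hanti hn) (hmin _ ⟨n, rfl⟩)⟩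

/-- The directional derivative of `f` at `v` is an integral sublinear minorant which is linear
along `v`. -/
lemma exists_le_map_neg (hf : IsIntSublinear f) (v : A) :
    ∃ g : A → ℤ, IsIntSublinear g ∧ (∀ x, g x ≤ f x) ∧ g (-v) = -g v ∧ g v = f v := by
  choose g m hg using hf.eventually_const v
  have hle : ∀ x, g x ≤ f x := fun x => by
    have h := hf.add_le x (m x • v)
    rw [hf.nsmul] at h
    linarith [hg x (m x) le_rfl]
  have hsub : IsIntSublinear g := by
    refine ⟨fun x y => ?_, fun k x => ?_⟩
    · set n := max (m x) (max (m y) (m (x + y)))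
      have hx := hg x n (by omega)
      have hy := hg y n (by omega)
      have hxy := hg (x + y) (n + n) (by omega)
      have h := hf.add_le (x + n • v) (y + n • v)
      rw [add_add_add_comm, ← add_nsmul] at h
      push_cast at hxy
      linarith
    · obtain rfl | hk := Nat.eq_zero_or_pos k
      · have h := hg 0 (m 0) le_rfl
        rw [zero_add, hf.nsmul] at h
        simp only [zero_smul, Nat.cast_zero, zero_mul]
        linarith
      · set n := max (m x) (m (k • x))
        have hx := hg x n (by omega)
        have hkx := hg (k • x) (k * n)
          ((le_max_right _ _).trans (Nat.le_mul_of_pos_left n hk))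
        rw [mul_nsmul', ← nsmul_add, hf.nsmul] at hkx
        push_cast at hkx
        rw [← hkx, ← hx]
        ring
  have hneg : g (-v) = -f v := by
    have h := hg (-v) (m (-v) + 1) (by omega)
    rw [succ_nsmul', neg_add_cancel_left, hf.nsmul] at h
    push_cast at h
    linarith
  have h₁ := hsub.add_neg_nonneg v
  have h₂ := hle v
  exact ⟨g, hsub, hle, by omega, by omega⟩

lemma exists_le_map_neg_finset (hf : IsIntSublinear f) (s : Finset A) :
    ∃ g : A → ℤ, IsIntSublinear g ∧ (∀ x, g x ≤ f x) ∧ ∀ w ∈ s, g (-w) = -g w := by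
  classical
  induction s using Finset.induction_on with
  | empty => exact ⟨f, hf, fun _ => le_rfl, by simp⟩
  | insert v s _ ih =>
    obtain ⟨g, hg, hgf, hgs⟩ := ih
    obtain ⟨k, hk, hkg, hkv, -⟩ := hg.exists_le_map_neg v
    refine ⟨k, hk, fun x => (hkg x).trans (hgf x), fun w hw => ?_⟩
    obtain rfl | hw := Finset.mem_insert.1 hw
    · exact hkv
    · exact (hk.map_neg_of_le hkg (hgs w hw)).1

/-- The subgroup of elements along which `f` is linear. -/
def linearityAddSubgroup (hf : IsIntSublinear f) : AddSubgroup A where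
  carrier := {w | f (-w) = -f w}
  zero_mem' := by simp [hf.map_zero]
  add_mem' := by
    intro a b ha hb
    have ha' : f (-(-a)) = -f (-a) := by rw [neg_neg, show f (-a) = -f a from ha, neg_neg]
    have h₁ := hf.map_add_of_map_neg hb a
    have h₂ := hf.map_add_of_map_neg ha' (-b)
    rw [← neg_add_rev, show f (-a) = -f a from ha, show f (-b) = -f b from hb] at h₂
    change f (-(a + b)) = -f (a + b)
    omega
  neg_mem' := by
    intro a ha
    change f (-(-a)) = -f (-a)
    rw [neg_neg, show f (-a) = -f a from ha, neg_neg]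

/-- Integral Hahn–Banach theorem on a finitely generated abelian group. -/
theorem exists_addMonoidHom_le [AddGroup.FG A] (hf : IsIntSublinear f) (v : A) :
    ∃ φ : A →+ ℤ, (∀ x, φ x ≤ f x) ∧ φ v = f v := by
  obtain ⟨s, hs⟩ := (AddGroup.FG.out : (⊤ : AddSubgroup A).FG)
  obtain ⟨g, hg, hgf, hgneg, hgv⟩ := hf.exists_le_map_neg v
  obtain ⟨k, hk, hkg, hks⟩ := hg.exists_le_map_neg_finset s
  have htop : ∀ w, k (-w) = -k w := fun w => by
    have hle : AddSubgroup.closure (s : Set A) ≤ hk.linearityAddSubgroup :=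
      (AddSubgroup.closure_le _).2 hks
    exact hle (hs ▸ AddSubgroup.mem_top w)
  exact ⟨⟨⟨k, hk.map_zero⟩, fun x w => hk.map_add_of_map_neg (htop w) x⟩,
    fun x => (hkg x).trans (hgf x), (hk.map_neg_of_le hkg hgneg).2.trans hgv⟩

end IsIntSublinear

/-- A closed subset of `ℝᵈ` containing the integer lattice and stable under division by positive
integers is everything. -/
lemma mem_of_isClosed_of_intCast_mem {d : ℕ} {C : Set (Fin d → ℝ)} (hC : IsClosed C)
    (hdiv : ∀ (n : ℕ) (x : Fin d → ℝ), 0 < n → (n : ℝ) • x ∈ C → x ∈ C)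
    (hint : ∀ a : Fin d → ℤ, (fun i => (a i : ℝ)) ∈ C) (x : Fin d → ℝ) : x ∈ C := by
  have hlim : Filter.Tendsto
      (fun (n : ℕ) (i : Fin d) => (⌊((n : ℝ) + 1) * x i⌋ : ℝ) / ((n : ℝ) + 1))
      Filter.atTop (nhds x) := by
    refine tendsto_pi_nhds.2 fun i => ?_
    have hlow : Filter.Tendsto (fun n : ℕ => x i - 1 / ((n : ℝ) + 1)) Filter.atTop
        (nhds (x i)) := by
      simpa using tendsto_const_nhds.sub (tendsto_one_div_add_atTop_nhds_zero_nat (𝕜 := ℝ))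
    refine tendsto_of_tendsto_of_tendsto_of_le_of_le hlow tendsto_const_nhds
      (fun n => ?_) fun n => ?_
    · have hn : (0 : ℝ) < n + 1 := by positivity
      have h := Int.lt_floor_add_one (((n : ℝ) + 1) * x i)
      simp only
      rw [le_div_iff₀ hn, sub_mul, one_div_mul_cancel hn.ne']
      linarith
    · have hn : (0 : ℝ) < n + 1 := by positivity
      have h := Int.floor_le (((n : ℝ) + 1) * x i)
      simp only
      rw [div_le_iff₀ hn]
      linarith
  refine hC.mem_of_tendsto hlim (Filter.Eventually.of_forall fun n => ?_)
  refine hdiv (n + 1) _ n.succ_pos ?_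
  convert hint fun i => ⌊((n : ℝ) + 1) * x i⌋ using 1
  ext i
  have hn : ((n : ℝ) + 1) ≠ 0 := by positivity
  simp only [Pi.smul_apply, smul_eq_mul, Nat.cast_add, Nat.cast_one]
  field_simp

namespace IsSeminorm

variable {d : ℕ} {N : (Fin d → ℝ) → ℝ}

lemma map_natCast_smul (hN : IsSeminorm N) (n : ℕ) (x : Fin d → ℝ) :
    N ((n : ℝ) • x) = n * N x := by
  rw [hN.1, abs_of_nonneg n.cast_nonneg]

protected lemma continuous (hN : IsSeminorm N) : Continuous N := by
  have hconv : ConvexOn ℝ Set.univ N := by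
    refine ⟨convex_univ, fun x _ y _ a b ha hb _ => ?_⟩
    have h := hN.2 (a • x) (b • y)
    rwa [hN.1, hN.1, abs_of_nonneg ha, abs_of_nonneg hb] at h
  exact hconv.locallyLipschitz.continuous

/-- An integral seminorm is supported at each lattice point by an integer point of its dual unit
ball. -/
lemma exists_isIntegerPoint_eq (hN : IsSeminorm N)
    (h_int : ∀ a : Fin d → ℤ, ∃ m : ℤ, N (fun i => (a i : ℝ)) = (m : ℝ)) (v : Fin d → ℤ) :
    ∃ y : Fin d → ℝ, (∀ x, ∑ i, x i * y i ≤ N x) ∧ IsIntegerPoint y ∧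
      ∑ i, (v i : ℝ) * y i = N (fun i => (v i : ℝ)) := by
  choose f hf using h_int
  have hsub : IsIntSublinear f := by
    refine ⟨fun x y => ?_, fun n x => ?_⟩
    · have h := hN.2 (fun i => (x i : ℝ)) (fun i => (y i : ℝ))
      rw [hf, hf, show ((fun i => (x i : ℝ)) + fun i => (y i : ℝ)) =
        fun i => (((x + y) i : ℤ) : ℝ) by ext; simp, hf] at h
      exact_mod_cast h
    · have h := hN.map_natCast_smul n (fun i => (x i : ℝ))
      rw [hf, show ((n : ℝ) • fun i => (x i : ℝ)) =
        fun i => (((n • x) i : ℤ) : ℝ) by ext; simp, hf] at h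
      exact_mod_cast h
  obtain ⟨φ, hφ, hφv⟩ := hsub.exists_addMonoidHom_le v
  have hsum : ∀ a : Fin d → ℤ,
      ∑ i, (a i : ℝ) * (φ (Pi.single i 1) : ℝ) = (φ a : ℝ) := fun a => by
    have h := φ.toIntLinearMap.pi_apply_eq_sum_univ a
    simp only [AddMonoidHom.coe_toIntLinearMap, smul_eq_mul] at h
    rw [h]
    push_cast
    refine Finset.sum_congr rfl fun i _ => ?_
    congr 3
    ext j
    simp [Pi.single_apply, eq_comm]
  refine ⟨fun i => (φ (Pi.single i 1) : ℝ), ?_, fun i => ⟨_, rfl⟩, ?_⟩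
  · refine mem_of_isClosed_of_intCast_mem
      (C := {x | ∑ i, x i * (φ (Pi.single i 1) : ℝ) ≤ N x})
      (isClosed_le (by fun_prop) hN.continuous) (fun n x hn hx => ?_) fun a => ?_
    · simp only [Set.mem_ofPred_eq, hN.map_natCast_smul, Pi.smul_apply, smul_eq_mul, mul_assoc,
        ← Finset.mul_sum] at hx
      exact le_of_mul_le_mul_left hx (Nat.cast_pos.2 hn)
    · simp only [Set.mem_ofPred_eq, hsum, hf]
      exact_mod_cast hφ a
  · rw [hsum, hφv, hf]

lemma finite_isIntegerPoint_dualBall (N : (Fin d → ℝ) → ℝ) :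
    ({y : Fin d → ℝ | ∀ x, ∑ i, x i * y i ≤ N x} ∩ {y | IsIntegerPoint y}).Finite := by
  refine ((Set.finite_Icc (fun i : Fin d => -⌈N (-Pi.single i 1)⌉)
    (fun i => ⌈N (Pi.single i 1)⌉)).image fun (a : Fin d → ℤ) i => (a i : ℝ)).subset ?_
  rintro y ⟨hy, hyint⟩
  choose a ha using hyint
  refine ⟨a, ⟨fun i => ?_, fun i => ?_⟩, funext fun i => (ha i).symm⟩
  · have h := (hy (-Pi.single i 1)).trans (Int.le_ceil _)
    simp only [Pi.neg_apply, Pi.single_apply, neg_mul, ite_mul, one_mul, zero_mul,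
      Finset.sum_neg_distrib, Finset.sum_ite_eq', Finset.mem_univ, if_true,
      ha] at h
    have h' : -a i ≤ ⌈N (-Pi.single i 1)⌉ := by exact_mod_cast h
    change -⌈N (-Pi.single i 1)⌉ ≤ a i
    omega
  · have h := (hy (Pi.single i 1)).trans (Int.le_ceil _)
    simp only [Pi.single_apply, ite_mul, one_mul, zero_mul, Finset.sum_ite_eq',
      Finset.mem_univ, if_true, ha] at h
    exact_mod_cast h

lemma convex_dualBall (N : (Fin d → ℝ) → ℝ) :
    Convex ℝ {y : Fin d → ℝ | ∀ x, ∑ i, x i * y i ≤ N x} := by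
  rw [Set.ofPred_forall]
  refine convex_iInter fun x => convex_halfSpace_le ⟨fun y z => ?_, fun c y => ?_⟩ _
  · simp [mul_add, Finset.sum_add_distrib]
  · simp [Finset.mul_sum, mul_left_comm]

end IsSeminorm

/-- for a seminorm `N` taking integer values on `ℤᵈ`, the set of integer
points of the dual unit ball `B*_N = {y | ∀ x, ⟨x,y⟩ ≤ N x}` is finite, and `B*_N`
is its convex hull. -/
theorem statement_3 (d : ℕ) (N : (Fin d → ℝ) → ℝ)
    (hN : IsSeminorm N)
    (h_int : ∀ a : Fin d → ℤ, ∃ m : ℤ, N (fun i => (a i : ℝ)) = (m : ℝ)) :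
    ({y : Fin d → ℝ | ∀ x, ∑ i, x i * y i ≤ N x} ∩ {y | IsIntegerPoint y}).Finite ∧
    {y : Fin d → ℝ | ∀ x, ∑ i, x i * y i ≤ N x} =
      convexHull ℝ ({y : Fin d → ℝ | ∀ x, ∑ i, x i * y i ≤ N x} ∩ {y | IsIntegerPoint y}) := by
 
  have hfin := IsSeminorm.finite_isIntegerPoint_dualBall N
  refine ⟨hfin, Set.Subset.antisymm (fun y hy => ?_)
    (convexHull_min Set.inter_subset_left (IsSeminorm.convex_dualBall N))⟩
  by_contra hy'
  obtain ⟨φ, u, hφ, hu⟩ := geometric_hahn_banach_closed_point (convex_convexHull ℝ _)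
    (hfin.isClosed_convexHull ℝ) hy'
  have hsum : ∀ z : Fin d → ℝ, φ z = ∑ i, φ (Pi.single i 1) * z i := fun z => by
    have h := φ.toLinearMap.pi_apply_eq_sum_univ z
    simp only [ContinuousLinearMap.coe_coe, smul_eq_mul] at h
    rw [h]
    refine Finset.sum_congr rfl fun i _ => ?_
    rw [mul_comm]
    congr 2
    ext j
    simp [Pi.single_apply, eq_comm]
  have hmem := mem_of_isClosed_of_intCast_mem
    (C := ⋃ z ∈ {y : Fin d → ℝ | ∀ x, ∑ i, x i * y i ≤ N x} ∩ {y | IsIntegerPoint y},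
      {x | ∑ i, x i * y i ≤ ∑ i, x i * z i})
    (hfin.isClosed_biUnion fun z _ => isClosed_le (by fun_prop) (by fun_prop))
    (fun n x hn hx => ?_) (fun a => ?_) (fun i => φ (Pi.single i 1))
  · simp only [Set.mem_iUnion₂, Set.mem_ofPred_eq, ← hsum] at hmem
    obtain ⟨z, hz, hyz⟩ := hmem
    exact (hu.trans_le hyz).not_gt (hφ z (subset_convexHull ℝ _ hz))
  · simp only [Set.mem_iUnion₂, Set.mem_ofPred_eq, Pi.smul_apply, smul_eq_mul, mul_assoc,
      ← Finset.mul_sum] at hx ⊢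
    obtain ⟨z, hz, hyz⟩ := hx
    exact ⟨z, hz, le_of_mul_le_mul_left hyz (Nat.cast_pos.2 hn)⟩
  · obtain ⟨z, hz, hzint, hza⟩ := hN.exists_isIntegerPoint_eq h_int a
    exact Set.mem_iUnion₂.2 ⟨z, ⟨hz, hzint⟩, (hy _).trans_eq hza.symm⟩
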